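/- arXiv:1912.09566 — 3 statements merged into one kernel-verified Lean document; each statement's English description precedes it below -/
import Mathlib

section
/- For all integers p, i and all natural numbers q, m with 0 ≤ q ≤ m, the pullback homomorphism Φ satisfies Φ(u1^p · u2^{i−p} · v1^q · v2^{m−q}) = Σ_{l=0}^{m} c_{ql} · z1^{3(p+q)−(i+2m)+l} · z2^{−3(p+q)+2(i+m)−l} · w1^{m−l} · w2^{l}, where the integers c_{ql} are defined by the polynomial identity (2X − Y)^q (−X + 2Y)^{m−q} = Σ_{l=0}^{m} c_{ql} X^{m−l} Y^{l}. -/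
open Finset

noncomputable section

/-- Exponent monoid: `(i₁, i₂, m₁, m₂)` encodes `z1^{i₁} z2^{i₂} w1^{m₁} w2^{m₂}`
(respectively `u1^{i₁} u2^{i₂} v1^{m₁} v2^{m₂}`). -/
abbrev Idx : Type := ℤ × ℤ × ℕ × ℕ

/-- `T = ℂ[z1^{±1}, z2^{±1}][w1, w2]`, as the monoid algebra of `ℤ × ℤ × ℕ × ℕ` over `ℂ`. -/
abbrev T : Type := AddMonoidAlgebra ℂ Idx

/-- `S = ℂ[u1^{±1}, u2^{±1}][v1, v2]`, as the monoid algebra of `ℤ × ℤ × ℕ × ℕ` over `ℂ`. -/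
abbrev S : Type := AddMonoidAlgebra ℂ Idx

/-- The z-monomial `z1^{i₁} z2^{i₂} w1^{m₁} w2^{m₂}` of full type `(i₁, i₂, m₁, m₂)`. -/
def mono (e : Idx) : T := AddMonoidAlgebra.single e 1

/-- The u-monomial `u1^{i₁} u2^{i₂} v1^{m₁} v2^{m₂}` of full type `(i₁, i₂, m₁, m₂)`. -/
def umono (e : Idx) : S := AddMonoidAlgebra.single e 1

theorem mono_mul (e f : Idx) : mono e * mono f = mono (e + f) := by
  simp [mono, AddMonoidAlgebra.single_mul_single]

theorem mono_pow (e : Idx) (n : ℕ) : mono e ^ n = mono (n • e) := by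
  simp [mono, AddMonoidAlgebra.single_pow]

theorem umono_eq_mono (e : Idx) : umono e = mono e := rfl

/-- The one-parameter group `n ↦ z1^{n a} z2^{n b}` of Laurent monomials. -/
def laurentPowers (a b : ℤ) : Multiplicative ℤ →* T where
  toFun n := mono (n.toAdd * a, n.toAdd * b, 0, 0)
  map_one' := by simp only [toAdd_one, zero_mul]; rfl
  map_mul' x y := by simp [mono_mul, add_mul]

theorem map_laurentPowers (Φ : T →ₐ[ℂ] T) {a b a' b' : ℤ}
    (h : Φ (mono (a, b, 0, 0)) = mono (a', b', 0, 0)) (n : ℤ) :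
    Φ (mono (n * a, n * b, 0, 0)) = mono (n * a', n * b', 0, 0) := by
  have key : (Φ : T →* T).comp (laurentPowers a b) = laurentPowers a' b' :=
    MonoidHom.ext_mint (by simpa [laurentPowers] using h)
  exact DFunLike.congr_fun key (Multiplicative.ofAdd n)

/-- A polynomial identity in two complex variables holds in every commutative `ℂ`-algebra. -/
theorem binary_form_identity {A : Type*} [CommRing A] [Algebra ℂ A] (q m : ℕ) (c : ℕ → ℤ)
    (hc : ∀ X Y : ℂ, (2 * X - Y) ^ q * (-X + 2 * Y) ^ (m - q)
        = ∑ l ∈ Finset.range (m + 1), (c l : ℂ) * X ^ (m - l) * Y ^ l) (x y : A) :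
    (2 * x - y) ^ q * (-x + 2 * y) ^ (m - q)
      = ∑ l ∈ Finset.range (m + 1), (c l : A) * x ^ (m - l) * y ^ l := by
  have key : ((2 * MvPolynomial.X 0 - MvPolynomial.X 1) ^ q *
      (-MvPolynomial.X 0 + 2 * MvPolynomial.X 1) ^ (m - q) : MvPolynomial (Fin 2) ℂ)
      = ∑ l ∈ Finset.range (m + 1),
        (c l : MvPolynomial (Fin 2) ℂ) * MvPolynomial.X 0 ^ (m - l) * MvPolynomial.X 1 ^ l :=
    MvPolynomial.funext fun v => by simpa using hc (v 0) (v 1)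
  simpa using congrArg (MvPolynomial.aeval ![x, y]) key

/-- Let `Φ : S → T` be the `ℂ`-algebra homomorphism with `Φ(u1) = z1²·z2⁻¹`,
`Φ(u2) = z2²·z1⁻¹`, `Φ(v1) = 2·z1·z2⁻¹·w1 − z1²·z2⁻²·w2`,
`Φ(v2) = −z2²·z1⁻²·w1 + 2·z2·z1⁻¹·w2`, and let the integers `c l` be defined by the
polynomial identity `(2X − Y)^q (−X + 2Y)^{m−q} = Σ_{l=0}^m (c l) X^{m−l} Y^l`.  Then for
all integers `p, i` and naturals `q ≤ m`,
`Φ(u1^p u2^{i−p} v1^q v2^{m−q})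
  = Σ_{l=0}^m (c l) · z1^{3(p+q)−(i+2m)+l} z2^{−3(p+q)+2(i+m)−l} w1^{m−l} w2^l`. -/
theorem pullback_of_u_monomial (Φ : S →ₐ[ℂ] T)
    (hΦu1 : Φ (umono (1, 0, 0, 0)) = mono (2, -1, 0, 0))
    (hΦu2 : Φ (umono (0, 1, 0, 0)) = mono (-1, 2, 0, 0))
    (hΦv1 : Φ (umono (0, 0, 1, 0)) = (2 : ℂ) • mono (1, -1, 1, 0) - mono (2, -2, 0, 1))
    (hΦv2 : Φ (umono (0, 0, 0, 1)) = -mono (-2, 2, 1, 0) + (2 : ℂ) • mono (-1, 1, 0, 1))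
    (p i : ℤ) (q m : ℕ) (hq : q ≤ m) (c : ℕ → ℤ)
    (hc : ∀ X Y : ℂ, (2 * X - Y) ^ q * (-X + 2 * Y) ^ (m - q)
        = ∑ l ∈ Finset.range (m + 1), (c l : ℂ) * X ^ (m - l) * Y ^ l) :
    Φ (umono (p, i - p, q, m - q))
      = ∑ l ∈ Finset.range (m + 1), (c l : ℂ) •
          mono (3 * (p + (q : ℤ)) - (i + 2 * (m : ℤ)) + (l : ℤ),
                -(3 * (p + (q : ℤ))) + 2 * (i + (m : ℤ)) - (l : ℤ), m - l, l) := by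
  simp only [umono_eq_mono] at *
  have hu1 := map_laurentPowers Φ hΦu1 p
  have hu2 := map_laurentPowers Φ hΦu2 (i - p)
  have hv1 : Φ (mono (0, 0, 1, 0)) =
      mono (1, -1, 0, 0) * (2 * mono (0, 0, 1, 0) - mono (1, -1, 0, 1)) := by
    rw [hΦv1, mul_sub, mul_left_comm, mono_mul, mono_mul, ofNat_smul_eq_nsmul, nsmul_eq_mul]
    simp
  have hv2 : Φ (mono (0, 0, 0, 1)) =
      mono (-2, 2, 0, 0) * (-mono (0, 0, 1, 0) + 2 * mono (1, -1, 0, 1)) := by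
    rw [hΦv2, mul_add, mul_neg, mul_left_comm, mono_mul, mono_mul, ofNat_smul_eq_nsmul,
      nsmul_eq_mul]
    simp
  have hsplit : mono (p, i - p, q, m - q) =
      mono (p * 1, p * 0, 0, 0) * mono ((i - p) * 0, (i - p) * 1, 0, 0) *
        (mono (0, 0, 1, 0) ^ q * mono (0, 0, 0, 1) ^ (m - q)) := by
    simp [mono_mul, mono_pow]
  rw [hsplit, map_mul, map_mul, map_mul, map_pow, map_pow, hu1, hu2, hv1, hv2, mul_pow, mul_pow,
    mul_mul_mul_comm (mono _ ^ q), binary_form_identity q m c hc, Finset.mul_sum, Finset.mul_sum]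
  refine Finset.sum_congr rfl fun l hl => ?_
  rw [Int.cast_smul_eq_zsmul, zsmul_eq_mul, mul_assoc (c l : T), mul_left_comm _ (c l : T),
    mul_left_comm _ (c l : T)]
  simp only [mono_mul, mono_pow]
  congr 2
  ext <;> simp [Nat.cast_sub hq] <;> ring
end
end

section
/- Fix integers i, m with m ≥ 0 and an integer k with k ≡ −(m+i) (mod 3), and set k' = (i+m+k)/3. For all integers p and all 0 ≤ q ≤ m, the pullback Φ(u1^p · u2^{i−p} · v1^q · v2^{m−q}) lies in the span V(k,i,m)_z where k = 3(p+q) − (i+m). Consequently, the u-monomials of type (i,m) whose pullback under Φ lies in V(k,i,m)_z are exactly those of full type (k'−m+l, i+m−k'−l, m−l, l) for l = 0,…,m, i.e., they form the collection B(k,i,m)_u. -/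
noncomputable section

/-- `V(k,i,m)_z`: the `ℂ`-span in `T` of the collection `B(k,i,m)_z` of z-monomials of
full type `(k−m+l, i+m−k−l, m−l, l)` for `l = 0, …, m`. -/
def Vz (k i : ℤ) (m : ℕ) : Submodule ℂ T :=
  Submodule.span ℂ
    ((fun l : ℕ => mono (k - (m : ℤ) + (l : ℤ), i + (m : ℤ) - k - (l : ℤ), m - l, l)) ''
      {l : ℕ | l ≤ m})

/-- The `ℤ × ℤ × ℕ`-valued degree of an exponent `(i₁, i₂, m₁, m₂)`: the index `k = i₁ + m₁` of the
space `V(k,i,m)_z` containing the monomial, together with its type `(i, m) = (i₁ + i₂, m₁ + m₂)`. -/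
def weight : Idx →+ ℤ × ℤ × ℕ where
  toFun e := (e.1 + e.2.2.1, e.1 + e.2.1, e.2.2.1 + e.2.2.2)
  map_zero' := by simp
  map_add' e e' := by
    ext <;> simp <;> ring

theorem weight_apply (a b : ℤ) (c d : ℕ) : weight (a, b, c, d) = (a + c, a + b, c + d) := rfl

/-- `V(k,i,m)_z` is the homogeneous component of `T` of degree `(k, i, m)`. -/
theorem Vz_eq_gradeBy (k i : ℤ) (m : ℕ) :
    Vz k i m = AddMonoidAlgebra.gradeBy ℂ weight (k, i, m) := by
  apply le_antisymm
  · refine Submodule.span_le.2 ?_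
    rintro _ ⟨l, hl, rfl⟩
    have hl : l ≤ m := hl
    have h : weight (k - (m : ℤ) + (l : ℤ), i + (m : ℤ) - k - (l : ℤ), m - l, l) = (k, i, m) := by
      rw [weight_apply]
      ext <;> push_cast [hl] <;> omega
    rw [← h]
    exact AddMonoidAlgebra.single_mem_gradeBy _ _ _
  · intro x hx
    rw [← AddMonoidAlgebra.sum_coeff_single x]
    refine Submodule.sum_mem _ fun e he => ?_
    have h := hx e he
    obtain ⟨a, b, c, d⟩ := e
    simp only [weight_apply, Prod.mk.injEq] at h
    obtain ⟨h₁, h₂, h₃⟩ := h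
    rw [← mul_one (x.coeff _), ← smul_eq_mul, ← AddMonoidAlgebra.smul_single]
    refine Submodule.smul_mem _ _ (Submodule.subset_span ⟨d, show d ≤ m by omega, ?_⟩)
    simp only [mono]
    congr 1
    ext <;> simp only <;> omega

theorem mono_mem_Vz {e : Idx} {k i : ℤ} {m : ℕ} (h : weight e = (k, i, m)) :
    mono e ∈ Vz k i m := by
  rw [Vz_eq_gradeBy, ← h]
  exact AddMonoidAlgebra.single_mem_gradeBy _ _ _

theorem mul_mem_Vz {x y : T} {k i k' i' : ℤ} {m m' : ℕ} (hx : x ∈ Vz k i m)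
    (hy : y ∈ Vz k' i' m') : x * y ∈ Vz (k + k') (i + i') (m + m') := by
  rw [Vz_eq_gradeBy] at *
  exact SetLike.mul_mem_graded hx hy

theorem pow_mem_Vz {x : T} {k i : ℤ} {m : ℕ} (hx : x ∈ Vz k i m) (n : ℕ) :
    x ^ n ∈ Vz (n * k) (n * i) (n * m) := by
  rw [Vz_eq_gradeBy] at *
  simpa using SetLike.pow_mem_graded n hx

theorem eq_of_mem_Vz {x : T} (hx : x ≠ 0) {k k' i : ℤ} {m : ℕ} (h : x ∈ Vz k i m)
    (h' : x ∈ Vz k' i m) : k = k' := by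
  rw [Vz_eq_gradeBy] at h h'
  obtain ⟨e, he⟩ : x.coeff.support.Nonempty := by
    rw [Finsupp.support_nonempty_iff]
    simpa using hx
  exact congrArg Prod.fst ((h e he).symm.trans (h' e he))

theorem mono_mul_mono (e e' : Idx) : mono e * mono e' = mono (e + e') := by
  simp [mono, AddMonoidAlgebra.single_mul_single]

theorem mono_ne_zero (e : Idx) : mono e ≠ 0 := by
  simp [mono]

theorem umono_eq_mul (p r : ℤ) (q s : ℕ) :
    umono (p, r, q, s) = umono (p, 0, 0, 0) * umono (0, r, 0, 0) *
      umono (0, 0, 1, 0) ^ q * umono (0, 0, 0, 1) ^ s := by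
  simp [umono, AddMonoidAlgebra.single_mul_single, AddMonoidAlgebra.single_pow]

/-- The homomorphism `p ↦ (z1^a z2^b)^p` given by the powers of a monomial without `w`-part. -/
def zmonoPow (a b : ℤ) : Multiplicative ℤ →* T where
  toFun p := mono (p.toAdd * a, p.toAdd * b, 0, 0)
  map_one' := by simp [mono, AddMonoidAlgebra.one_def]; rfl
  map_mul' p p' := by simp [mono_mul_mono, add_mul]

theorem map_umono_zpow (Φ : S →ₐ[ℂ] T) {a b c d : ℤ}
    (h : Φ (umono (a, b, 0, 0)) = mono (c, d, 0, 0)) (p : ℤ) :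
    Φ (umono (p * a, p * b, 0, 0)) = mono (p * c, p * d, 0, 0) := by
  have : (Φ : S →* T).comp (zmonoPow a b) = zmonoPow c d :=
    MonoidHom.ext_mint (by simpa [zmonoPow, mono, umono] using h)
  exact DFunLike.congr_fun this (Multiplicative.ofAdd p)

/-- Let `Φ : S → T` be the pullback `ℂ`-algebra homomorphism (`Φ(u1) = z1²·z2⁻¹`,
`Φ(u2) = z2²·z1⁻¹`, `Φ(v1) = 2·z1·z2⁻¹·w1 − z1²·z2⁻²·w2`,
`Φ(v2) = −z2²·z1⁻²·w1 + 2·z2·z1⁻¹·w2`).  Fix `i : ℤ`, `m : ℕ`, an integer `k` with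
`k ≡ −(m+i) (mod 3)`, and `k' = (i+m+k)/3`.  Then:
(a) for all `p : ℤ` and `0 ≤ q ≤ m`, the pullback `Φ(u1^p u2^{i−p} v1^q v2^{m−q})` lies in
    `V(3(p+q)−(i+m), i, m)_z`;
(b) the u-monomials of type `(i,m)` whose pullback lies in `V(k,i,m)_z` are exactly those
    of full type `(k'−m+l, i+m−k'−l, m−l, l)` for some `l = 0, …, m`, i.e. the members of
    the collection `B(k,i,m)_u`. -/
theorem pullback_lies_in_Vz (Φ : S →ₐ[ℂ] T)
    (hΦu1 : Φ (umono (1, 0, 0, 0)) = mono (2, -1, 0, 0))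
    (hΦu2 : Φ (umono (0, 1, 0, 0)) = mono (-1, 2, 0, 0))
    (hΦv1 : Φ (umono (0, 0, 1, 0)) = (2 : ℂ) • mono (1, -1, 1, 0) - mono (2, -2, 0, 1))
    (hΦv2 : Φ (umono (0, 0, 0, 1)) = -mono (-2, 2, 1, 0) + (2 : ℂ) • mono (-1, 1, 0, 1))
    (i : ℤ) (m : ℕ) (k k' : ℤ) (hk : k ≡ -((m : ℤ) + i) [ZMOD 3])
    (hk' : 3 * k' = i + (m : ℤ) + k) :
    (∀ (p : ℤ) (q : ℕ), q ≤ m →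
        Φ (umono (p, i - p, q, m - q)) ∈ Vz (3 * (p + (q : ℤ)) - (i + (m : ℤ))) i m)
    ∧ (∀ (p : ℤ) (q : ℕ), q ≤ m →
        (Φ (umono (p, i - p, q, m - q)) ∈ Vz k i m ↔
          ∃ l : ℕ, l ≤ m ∧
            ((p, i - p, q, m - q) : Idx)
              = (k' - (m : ℤ) + (l : ℤ), i + (m : ℤ) - k' - (l : ℤ), m - l, l))) := by
  have hw₁ : Φ (umono (0, 0, 1, 0)) ∈ Vz 2 0 1 := by
    rw [hΦv1]
    exact sub_mem (Submodule.smul_mem _ _ (mono_mem_Vz rfl)) (mono_mem_Vz rfl)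
  have hw₂ : Φ (umono (0, 0, 0, 1)) ∈ Vz (-1) 0 1 := by
    rw [hΦv2]
    exact add_mem (neg_mem (mono_mem_Vz rfl)) (Submodule.smul_mem _ _ (mono_mem_Vz rfl))
  have hne₁ : Φ (umono (0, 0, 1, 0)) ≠ 0 := by
    rw [hΦv1]
    intro h
    simpa [mono, Finsupp.single_apply] using
      congrArg (fun x : T => x.coeff (1, -1, 1, 0)) h
  have hne₂ : Φ (umono (0, 0, 0, 1)) ≠ 0 := by
    rw [hΦv2]
    intro h
    simpa [mono, Finsupp.single_apply] using
      congrArg (fun x : T => x.coeff (-1, 1, 0, 1)) h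
  have hu₁ (p : ℤ) : Φ (umono (p, 0, 0, 0)) = mono (p * 2, p * -1, 0, 0) := by
    simpa using map_umono_zpow Φ hΦu1 p
  have hu₂ (p : ℤ) : Φ (umono (0, p, 0, 0)) = mono (p * -1, p * 2, 0, 0) := by
    simpa using map_umono_zpow Φ hΦu2 p
  have mem (p : ℤ) (q : ℕ) (hq : q ≤ m) :
      Φ (umono (p, i - p, q, m - q)) ∈ Vz (3 * (p + (q : ℤ)) - (i + (m : ℤ))) i m := by
    rw [umono_eq_mul, map_mul, map_mul, map_mul, map_pow, map_pow, hu₁, hu₂, mono_mul_mono]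
    have h := mul_mem_Vz (mul_mem_Vz (mono_mem_Vz (e := (p * 2, p * -1, 0, 0) +
      ((i - p) * -1, (i - p) * 2, 0, 0)) rfl) (pow_mem_Vz hw₁ q)) (pow_mem_Vz hw₂ (m - q))
    convert h using 1
    simp only [Prod.mk_add_mk]
    congr 1 <;> push_cast [hq] <;> omega
  have ne_zero (p r : ℤ) (q s : ℕ) : Φ (umono (p, r, q, s)) ≠ 0 := by
    rw [umono_eq_mul, map_mul, map_mul, map_mul, map_pow, map_pow, hu₁, hu₂, mono_mul_mono]
    exact mul_ne_zero (mul_ne_zero (mono_ne_zero _) (pow_ne_zero _ hne₁)) (pow_ne_zero _ hne₂)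
  refine ⟨mem, fun p q hq => ⟨fun h => ⟨m - q, Nat.sub_le _ _, ?_⟩, ?_⟩⟩
  · have hkpq := eq_of_mem_Vz (ne_zero _ _ _ _) h (mem p q hq)
    ext <;> push_cast [hq] <;> omega
  · rintro ⟨l, hl, h⟩
    simp only [Prod.mk.injEq] at h
    convert mem p q hq using 2
    omega
end
end

section
/- For a natural number d, define ℓ(d) = (1/2)·d·(d−1)·⌊d/3⌋ + (1/3)·d·(d−3)·(⌊(d−1)/2⌋ − ⌊d/3⌋) if 3 divides d, and ℓ(d) = (1/2)·d·(d−1)·⌊d/3⌋ + (1/3)·(d·(d−3)+2)·(⌊(d−1)/2⌋ − ⌊d/3⌋) otherwise. Then 67·ℓ(d) > 72·(2d² − 5d) holds for d = 9 and for every d ≥ 11. -/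
/-- Labs' lower bound `ℓ(d)` for the maximal number of `A₂` singularities on a degree `d`
hypersurface in `ℙ³`:
`ℓ(d) = (1/2)·d·(d−1)·⌊d/3⌋ + (1/3)·d·(d−3)·(⌊(d−1)/2⌋ − ⌊d/3⌋)` if `3 ∣ d`, and
`ℓ(d) = (1/2)·d·(d−1)·⌊d/3⌋ + (1/3)·(d·(d−3)+2)·(⌊(d−1)/2⌋ − ⌊d/3⌋)` otherwise. -/
def labsBound (d : ℕ) : ℚ :=
  if 3 ∣ d then
    (1 / 2) * d * ((d : ℚ) - 1) * ((d / 3 : ℕ) : ℚ)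
      + (1 / 3) * d * ((d : ℚ) - 3) * ((((d - 1) / 2 : ℕ) : ℚ) - ((d / 3 : ℕ) : ℚ))
  else
    (1 / 2) * d * ((d : ℚ) - 1) * ((d / 3 : ℕ) : ℚ)
      + (1 / 3) * ((d : ℚ) * ((d : ℚ) - 3) + 2) * ((((d - 1) / 2 : ℕ) : ℚ) - ((d / 3 : ℕ) : ℚ))

/-- For `d = 9` and every `d ≥ 11`, one has `67·ℓ(d) > 72·(2d² − 5d)`. -/
theorem labsBound_inequality (d : ℕ) (hd : d = 9 ∨ 11 ≤ d) :
    67 * labsBound d > 72 * (2 * (d : ℚ) ^ 2 - 5 * (d : ℚ)) := by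
  obtain ⟨m, c, hc, rfl⟩ : ∃ m c : ℕ,
      (c = 9 ∨ c = 11 ∨ c = 12 ∨ c = 13 ∨ c = 14 ∨ c = 16) ∧ d = 6 * m + c := by
    have h : d % 6 < 6 := Nat.mod_lt _ (by norm_num)
    interval_cases hr : d % 6
    · exact ⟨d / 6 - 2, 12, by omega, by omega⟩
    · exact ⟨d / 6 - 2, 13, by omega, by omega⟩
    · exact ⟨d / 6 - 2, 14, by omega, by omega⟩
    · exact ⟨d / 6 - 1, 9, by omega, by omega⟩
    · exact ⟨d / 6 - 2, 16, by omega, by omega⟩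
    · exact ⟨d / 6 - 1, 11, by omega, by omega⟩
  have h_third : (6 * m + c) / 3 = 2 * m + c / 3 := by omega
  have h_half : (6 * m + c - 1) / 2 = 3 * m + (c - 1) / 2 := by omega
  have h_dvd : 3 ∣ 6 * m + c ↔ 3 ∣ c := by omega
  have hm : (0 : ℚ) ≤ m := m.cast_nonneg
  have hm2 : (0 : ℚ) ≤ (m : ℚ) ^ 2 := by positivity
  have hm3 : (0 : ℚ) ≤ (m : ℚ) ^ 3 := by positivity
  simp only [labsBound, h_third, h_half, h_dvd]
  rcases hc with rfl | rfl | rfl | rfl | rfl | rfl <;> norm_num <;> ring_nf <;> linarith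
end
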